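/- arXiv:math/0503433 — 4 statements merged into one kernel-verified Lean document; each statement's English description precedes it below -/
import Mathlib

section
/- Let X be a compact metric space, f : X → X a measurable map, C ⊆ X a nonempty closed set, and μ an ergodic f-invariant Borel probability measure on X such that the function x ↦ log dist(x,C) is μ-integrable. Then for every ε > 0 there exists δ > 0 such that for μ-almost every x ∈ X, limsup_{n→∞} (1/n) ∑_{j=0}^{n−1} −log dist_δ(f^j(x),C) ≤ ε. -/
open MeasureTheory Filter Metric Set

/-- The δ-truncated distance to the set `C`. -/
noncomputable def truncDist {X : Type*} [MetricSpace X] (δ : ℝ) (C : Set X) (x : X) : ℝ :=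
  if infDist x C ≤ δ then infDist x C else 1

/-- The running maximum `max_{0 ≤ k ≤ n} S_k h` of the Birkhoff sums of `h`, defined by
recursion along the dynamics. -/
noncomputable def maxBirkhoffSum {X : Type*} (f : X → X) (h : X → ℝ) : ℕ → X → ℝ
  | 0, _ => 0
  | n + 1, x => max 0 (h x + maxBirkhoffSum f h n (f x))

section MaxBirkhoffSum

variable {X : Type*} {f : X → X} {h : X → ℝ}

lemma maxBirkhoffSum_nonneg (n : ℕ) (x : X) : 0 ≤ maxBirkhoffSum f h n x := by
  cases n with
  | zero => exact le_rfl
  | succ n => exact le_max_left _ _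

lemma birkhoffSum_le_maxBirkhoffSum (n : ℕ) (x : X) :
    birkhoffSum f h n x ≤ maxBirkhoffSum f h n x := by
  induction n generalizing x with
  | zero => simp [maxBirkhoffSum]
  | succ n ih =>
    rw [birkhoffSum_succ']
    exact le_trans (by gcongr; exact ih (f x)) (le_max_right _ _)

lemma monotone_maxBirkhoffSum (x : X) : Monotone fun n => maxBirkhoffSum f h n x := by
  refine monotone_nat_of_le_succ fun n => ?_
  induction n generalizing x with
  | zero => exact maxBirkhoffSum_nonneg 1 x
  | succ n ih => exact max_le_max le_rfl (by gcongr; exact ih (f x))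

lemma maxBirkhoffSum_succ_sub (n : ℕ) (x : X) :
    maxBirkhoffSum f h (n + 1) x - maxBirkhoffSum f h n (f x) =
      max (-maxBirkhoffSum f h n (f x)) (h x) := by
  rw [maxBirkhoffSum, ← max_sub_sub_right]
  simp

lemma integrable_maxBirkhoffSum [MeasurableSpace X] {μ : Measure X}
    (hf : MeasurePreserving f μ μ) (hh : Integrable h μ) (n : ℕ) :
    Integrable (maxBirkhoffSum f h n) μ := by
  induction n with
  | zero => exact integrable_zero _ _ _
  | succ n ih =>
    exact (integrable_zero X ℝ μ).sup (hh.add (hf.integrable_comp_of_integrable ih))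

/-- If the Birkhoff sums of an integrable function are almost everywhere unbounded above, then
its integral is nonnegative. -/
lemma integral_nonneg_of_ae_not_bddAbove_birkhoffSum [MeasurableSpace X] {μ : Measure X}
    (hf : MeasurePreserving f μ μ) (hh : Integrable h μ)
    (hunb : ∀ᵐ x ∂μ, ¬ BddAbove (range fun n => birkhoffSum f h n x)) :
    0 ≤ ∫ x, h x ∂μ := by
  have hMf (n : ℕ) : Integrable (fun x => maxBirkhoffSum f h n (f x)) μ :=
    hf.integrable_comp_of_integrable (integrable_maxBirkhoffSum hf hh n)
  have hlim : Tendsto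
      (fun n => ∫ x, (maxBirkhoffSum f h (n + 1) x - maxBirkhoffSum f h n (f x)) ∂μ)
      atTop (nhds (∫ x, h x ∂μ)) := by
    refine tendsto_integral_of_dominated_convergence (fun x => |h x|)
      (fun n => ((integrable_maxBirkhoffSum hf hh _).sub (hMf n)).aestronglyMeasurable)
      hh.abs (fun n => ae_of_all _ fun x => ?_) ?_
    · have hM := maxBirkhoffSum_nonneg (f := f) (h := h) n (f x)
      rw [maxBirkhoffSum_succ_sub, Real.norm_eq_abs, abs_le]
      exact ⟨(neg_abs_le _).trans (le_max_right _ _),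
        max_le (by linarith [abs_nonneg (h x)]) (le_abs_self _)⟩
    · filter_upwards [hunb] with x hx
      obtain ⟨n, hn⟩ : ∃ n, 0 < birkhoffSum f h (n + 1) x := by
        by_contra! hle
        refine hx ⟨0, ?_⟩
        rintro _ ⟨n, rfl⟩
        cases n with
        | zero => simp
        | succ n => exact hle n
      refine tendsto_const_nhds.congr' ?_
      filter_upwards [eventually_ge_atTop n] with m hm
      have hS := birkhoffSum_le_maxBirkhoffSum (f := f) (h := h) n (f x)
      have hM := monotone_maxBirkhoffSum (f := f) (h := h) (f x) hm
      rw [birkhoffSum_succ'] at hn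
      rw [maxBirkhoffSum_succ_sub, max_eq_right]
      dsimp only at hM
      linarith
  refine ge_of_tendsto' hlim fun n => ?_
  have hcomp : ∫ x, maxBirkhoffSum f h n (f x) ∂μ = ∫ x, maxBirkhoffSum f h n x ∂μ := by
    conv_rhs => rw [← hf.map_eq]
    refine (integral_map hf.aemeasurable ?_).symm
    rw [hf.map_eq]
    exact (integrable_maxBirkhoffSum hf hh n).aestronglyMeasurable
  rw [integral_sub (integrable_maxBirkhoffSum hf hh _) (hMf n), hcomp, sub_nonneg]
  exact integral_mono (integrable_maxBirkhoffSum hf hh _) (integrable_maxBirkhoffSum hf hh _)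
    fun x => monotone_maxBirkhoffSum x n.le_succ

end MaxBirkhoffSum

lemma bddAbove_birkhoffSum_apply_iff {X : Type*} (f : X → X) (h : X → ℝ) (x : X) :
    BddAbove (range fun n => birkhoffSum f h n (f x)) ↔
      BddAbove (range fun n => birkhoffSum f h n x) := by
  constructor
  · rintro ⟨K, hK⟩
    refine ⟨max 0 (h x + K), ?_⟩
    rintro _ ⟨n, rfl⟩
    cases n with
    | zero => simp
    | succ n =>
      refine le_max_of_le_right ?_
      simp only [birkhoffSum_succ']
      gcongr
      exact hK ⟨n, rfl⟩
  · rintro ⟨K, hK⟩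
    refine ⟨K - h x, ?_⟩
    rintro _ ⟨n, rfl⟩
    have := hK ⟨n + 1, rfl⟩
    simp only [birkhoffSum_succ'] at this
    dsimp only
    linarith

lemma measurable_birkhoffSum {X : Type*} [MeasurableSpace X] {f : X → X} {h : X → ℝ}
    (hf : Measurable f) (hh : Measurable h) (n : ℕ) : Measurable (birkhoffSum f h n) :=
  Finset.measurable_fun_sum _ fun j _ => hh.comp (hf.iterate j)

/-- For an ergodic map, the Birkhoff sums of a function with negative integral are almost
everywhere bounded above. -/
lemma Ergodic.ae_bddAbove_birkhoffSum {X : Type*} [MeasurableSpace X] {μ : Measure X}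
    {f : X → X} {h : X → ℝ} (hf : Ergodic f μ) (hhm : Measurable h) (hh : Integrable h μ)
    (hneg : ∫ x, h x ∂μ < 0) :
    ∀ᵐ x ∂μ, BddAbove (range fun n => birkhoffSum f h n x) := by
  have hmeas : MeasurableSet {x | BddAbove (range fun n => birkhoffSum f h n x)} :=
    measurableSet_bddAbove_range fun n => measurable_birkhoffSum hf.measurable hhm n
  refine (hf.toPreErgodic.ae_mem_or_ae_notMem hmeas
    (Set.ext fun x => bddAbove_birkhoffSum_apply_iff f h x)).resolve_right fun hunb => ?_
  exact hneg.not_ge (integral_nonneg_of_ae_not_bddAbove_birkhoffSum hf.toMeasurePreserving hh hunb)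

/-- For an ergodic map, the limsup of the Birkhoff averages of a nonnegative function is almost
everywhere at most any number exceeding its integral. -/
lemma Ergodic.ae_limsup_birkhoffAverage_le {X : Type*} [MeasurableSpace X] {μ : Measure X}
    [IsProbabilityMeasure μ] {f : X → X} {g : X → ℝ} (hf : Ergodic f μ) (hgm : Measurable g)
    (hg : Integrable g μ) (hg0 : ∀ x, 0 ≤ g x) {ε : ℝ} (hε : ∫ x, g x ∂μ < ε) :
    ∀ᵐ x ∂μ, atTop.limsup (fun n : ℕ => (n : ℝ)⁻¹ * birkhoffSum f g n x) ≤ ε := by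
  have hneg : ∫ x, (g x - ε) ∂μ < 0 := by
    rw [integral_sub hg (integrable_const _)]
    simpa using hε
  filter_upwards [hf.ae_bddAbove_birkhoffSum (hgm.sub_const ε) (hg.sub (integrable_const _)) hneg]
    with x ⟨K, hK⟩
  have hlim : Tendsto (fun n : ℕ => ε + (n : ℝ)⁻¹ * K) atTop (nhds ε) := by
    simpa using (tendsto_inv_atTop_nhds_zero_nat (𝕜 := ℝ)).mul_const K |>.const_add ε
  rw [← hlim.limsup_eq]
  refine limsup_le_limsup ?_ ?_ hlim.isBoundedUnder_le
  · filter_upwards [eventually_gt_atTop 0] with n hn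
    have hS : birkhoffSum f (fun x => g x - ε) n x ≤ K := hK ⟨n, rfl⟩
    have hn' : (0 : ℝ) < n := by exact_mod_cast hn
    have hsum : birkhoffSum f g n x ≤ n * ε + K := by
      simp only [birkhoffSum, Finset.sum_sub_distrib, Finset.sum_const, Finset.card_range,
        nsmul_eq_mul] at hS ⊢
      linarith
    calc (n : ℝ)⁻¹ * birkhoffSum f g n x ≤ (n : ℝ)⁻¹ * (n * ε + K) := by gcongr
      _ = ε + (n : ℝ)⁻¹ * K := by field_simp
  · refine isCoboundedUnder_le_of_le atTop (x := 0) fun n => ?_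
    exact mul_nonneg (by positivity) (Finset.sum_nonneg fun j _ => hg0 _)

section TruncDist

variable {X : Type*} [MetricSpace X]

lemma measurable_truncDist [MeasurableSpace X] [BorelSpace X] (δ : ℝ) (C : Set X) :
    Measurable (truncDist δ C) :=
  Measurable.ite (measurableSet_le measurable_infDist measurable_const)
    measurable_infDist measurable_const

lemma neg_log_truncDist_nonneg {δ : ℝ} (hδ : δ ≤ 1) (C : Set X) (x : X) :
    0 ≤ -Real.log (truncDist δ C x) := by
  unfold truncDist
  split_ifs with h
  · linarith [Real.log_nonpos infDist_nonneg (h.trans hδ)]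
  · simp

lemma abs_neg_log_truncDist_le (δ : ℝ) (C : Set X) (x : X) :
    |-Real.log (truncDist δ C x)| ≤ |Real.log (infDist x C)| := by
  unfold truncDist
  split_ifs <;> simp

lemma integrable_neg_log_truncDist [MeasurableSpace X] [BorelSpace X] {μ : Measure X} {C : Set X}
    (hint : Integrable (fun x => Real.log (infDist x C)) μ) (δ : ℝ) :
    Integrable (fun x => -Real.log (truncDist δ C x)) μ :=
  hint.mono (Real.measurable_log.comp (measurable_truncDist δ C)).neg.aestronglyMeasurable
    (ae_of_all _ (abs_neg_log_truncDist_le δ C))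

lemma tendsto_integral_neg_log_truncDist [MeasurableSpace X] [BorelSpace X] {μ : Measure X}
    {C : Set X} (hint : Integrable (fun x => Real.log (infDist x C)) μ) :
    Tendsto (fun δ => ∫ x, -Real.log (truncDist δ C x) ∂μ) (nhdsWithin 0 (Ioi 0)) (nhds 0) := by
  refine (integral_zero X ℝ (μ := μ)).subst (motive := fun r => Tendsto _ _ (nhds r)) ?_
  refine tendsto_integral_filter_of_dominated_convergence (fun x => |Real.log (infDist x C)|)
    (.of_forall fun δ => (integrable_neg_log_truncDist hint δ).aestronglyMeasurable)
    (.of_forall fun δ => ae_of_all _ (abs_neg_log_truncDist_le δ C)) hint.abs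
    (ae_of_all _ fun x => tendsto_const_nhds.congr' ?_)
  rcases (infDist_nonneg (x := x) (s := C)).eq_or_lt with h0 | hpos
  · exact .of_forall fun δ => by dsimp only [truncDist]; split_ifs <;> simp [← h0]
  · filter_upwards [Ioo_mem_nhdsGT hpos] with δ hδ
    simp [truncDist, hδ.2.not_ge]

end TruncDist

/-- If `μ` is an ergodic `f`-invariant Borel probability measure for which
`log dist(·,C)` is integrable, then the Birkhoff averages of the truncated log-distance
are eventually small: for every `ε > 0` there is `δ > 0` such that for `μ`-a.e. `x`,
`limsup (1/n) ∑ -log dist_δ(fʲ x, C) ≤ ε`. -/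
theorem slow_approximation_of_ergodic_log_integrable
    {X : Type*} [MetricSpace X] [CompactSpace X] [MeasurableSpace X] [BorelSpace X]
    (f : X → X) (hf : Measurable f)
    (C : Set X) (hCne : C.Nonempty) (hCcl : IsClosed C)
    (μ : Measure X) [IsProbabilityMeasure μ]
    (hinv : ∀ A : Set X, MeasurableSet A → μ (f ⁻¹' A) = μ A)
    (herg : ∀ A : Set X, MeasurableSet A → f ⁻¹' A = A → μ A = 0 ∨ μ A = 1)
    (hint : Integrable (fun x => Real.log (infDist x C)) μ) :
    ∀ ε > (0:ℝ), ∃ δ > (0:ℝ), ∀ᵐ x ∂μ,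
      atTop.limsup (fun n : ℕ =>
        (n : ℝ)⁻¹ * ∑ j ∈ Finset.range n, -Real.log (truncDist δ C (f^[j] x))) ≤ ε := by
  have hmp : MeasurePreserving f μ μ :=
    ⟨hf, Measure.ext fun A hA => by rw [Measure.map_apply hf hA, hinv A hA]⟩
  have hergodic : Ergodic f μ :=
    { hmp with
      aeconst_set := fun A hA hfA => by
        rw [eventuallyConst_set']
        rcases herg A hA hfA with h0 | h1
        · exact Or.inl (ae_eq_empty.2 h0)
        · exact Or.inr ((ae_eq_univ_iff_measure_eq hA.nullMeasurableSet).2 (by simpa using h1)) }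
  intro ε hε
  obtain ⟨δ, hδε, hδ⟩ := (((tendsto_integral_neg_log_truncDist hint).eventually_lt_const hε).and
    (Ioo_mem_nhdsGT one_pos)).exists
  exact ⟨δ, hδ.1, hergodic.ae_limsup_birkhoffAverage_le
    (Real.measurable_log.comp (measurable_truncDist δ C)).neg (integrable_neg_log_truncDist hint δ)
    (neg_log_truncDist_nonneg hδ.2.le C) hδε⟩
end

section
/- Let E be a d-dimensional real inner product space, C ⊆ E a closed set, and f : E → E a map differentiable at every point of E \ C with det Df ≠ 0 there, satisfying the distortion condition: there exist B > 0 and β > 0 such that |log|det Df(x)| − log|det Df(y)|| ≤ B·dist(x,y)/dist(x,C)^β whenever x, y ∈ E\C and dist(x,y) < dist(x,C)/2. Fix σ ∈ (0,1), δ₁ ∈ (0,1), and b > 0 with b ≤ 1/2 and bβ < 1/2. Let n ≥ 1 and let p, q ∈ E be points whose orbits satisfy, for every 0 ≤ j < n: (i) f^j(p), f^j(q) ∉ C; (ii) dist(f^j(p), f^j(q)) ≤ σ^{(n−j)/2}·D, where D := dist(f^n(p), f^n(q)) ≤ δ₁; (iii) dist(f^j(q), C) ≥ (1−δ₁)·σ^{b(n−j)};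 and (iv) dist(f^j(p), f^j(q)) < dist(f^j(q),C)/2. Then |∑_{j=0}^{n−1} (log|det Df(f^j(q))| − log|det Df(f^j(p))|)| ≤ (B / ((1−δ₁)^β (1 − σ^{1/2−bβ}))) · D. -/
open Metric Set Filter

/-- A finite geometric sum summed backwards from the exponent `n` down to `1` is at most
`(1 - r)⁻¹`. -/
theorem sum_range_pow_sub_le_inv_one_sub {r : ℝ} (hr0 : 0 ≤ r) (hr1 : r < 1) (n : ℕ) :
    ∑ j ∈ Finset.range n, r ^ (n - j) ≤ (1 - r)⁻¹ := by
  have hreflect : ∑ j ∈ Finset.range n, r ^ (n - j) = ∑ j ∈ Finset.range n, r ^ (j + 1) := by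
    rw [← Finset.sum_range_reflect]
    refine Finset.sum_congr rfl fun j hj => ?_
    have := Finset.mem_range.mp hj
    congr 1
    omega
  calc ∑ j ∈ Finset.range n, r ^ (n - j)
      = ∑ j ∈ Finset.range n, r ^ (j + 1) := hreflect
    _ ≤ ∑ j ∈ Finset.range n, r ^ j :=
        Finset.sum_le_sum fun j _ => pow_le_pow_of_le_one hr0 hr1.le j.le_succ
    _ ≤ ∑' j : ℕ, r ^ j :=
        (summable_geometric_of_lt_one hr0 hr1).sum_le_tsum _ fun j _ => pow_nonneg hr0 j
    _ = (1 - r)⁻¹ := tsum_geometric_of_lt_one hr0 hr1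

/-- If `t ≤ σ ^ (k / 2) * D` and `(1 - δ) * σ ^ (b * k) ≤ s`, then `B * t / s ^ β` is at most
a constant times the `k`-th power of `σ ^ (1 / 2 - b * β)`. -/
theorem mul_div_rpow_le_mul_rpow_pow {B β σ δ b D s t : ℝ} (hB : 0 ≤ B) (hβ : 0 ≤ β)
    (hσ : 0 < σ) (hδ : δ < 1) (hD : 0 ≤ D) (k : ℕ)
    (ht : t ≤ σ ^ ((k : ℝ) / 2) * D) (hs : (1 - δ) * σ ^ (b * (k : ℝ)) ≤ s) :
    B * t / s ^ β ≤ B * D / (1 - δ) ^ β * (σ ^ (1 / 2 - b * β)) ^ k := by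
  have hδ' : 0 < 1 - δ := sub_pos.mpr hδ
  have hpow : (1 - δ) ^ β * σ ^ (b * (k : ℝ) * β) ≤ s ^ β := by
    rw [Real.rpow_mul hσ.le, ← Real.mul_rpow hδ'.le (by positivity)]
    exact Real.rpow_le_rpow (by positivity) hs hβ
  calc B * t / s ^ β
      ≤ B * (σ ^ ((k : ℝ) / 2) * D) / ((1 - δ) ^ β * σ ^ (b * (k : ℝ) * β)) := by gcongr
    _ = B * D / (1 - δ) ^ β * (σ ^ ((k : ℝ) / 2) / σ ^ (b * (k : ℝ) * β)) := by
        field_simp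
    _ = B * D / (1 - δ) ^ β * (σ ^ (1 / 2 - b * β)) ^ k := by
        rw [← Real.rpow_sub hσ, ← Real.rpow_mul_natCast hσ.le]
        ring_nf

/-- Bounded distortion along orbits up to a hyperbolic time (item (3) of Proposition 2.5):
under contraction of distances backwards in time and the non-degeneracy (distortion)
condition on `det Df`, the sum of the differences of `log |det Df|` along the two orbits is
bounded by `ρ · dist(fⁿ p, fⁿ q)` with `ρ = B/((1-δ₁)^β (1-σ^{1/2-bβ}))`. -/
theorem bounded_distortion_at_hyperbolic_time
    {E : Type*} [NormedAddCommGroup E] [InnerProductSpace ℝ E] [FiniteDimensional ℝ E]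
    (d : ℕ) (hdim : Module.finrank ℝ E = d)
    (C : Set E) (hCcl : IsClosed C)
    (f : E → E)
    (B β : ℝ) (hB : 0 < B) (hβ : 0 < β)
    (hdiff : ∀ x, x ∉ C → DifferentiableAt ℝ f x ∧ (fderiv ℝ f x).det ≠ 0)
    (hdistort : ∀ x y : E, x ∉ C → y ∉ C → dist x y < infDist x C / 2 →
      abs (Real.log |(fderiv ℝ f x).det| - Real.log |(fderiv ℝ f y).det|)
        ≤ B * dist x y / infDist x C ^ β)
    (σ δ₁ b : ℝ) (hσ0 : 0 < σ) (hσ1 : σ < 1) (hδ₁0 : 0 < δ₁) (hδ₁1 : δ₁ < 1)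
    (hb0 : 0 < b) (hb : b ≤ 1 / 2) (hbβ : b * β < 1 / 2)
    (n : ℕ) (hn : 1 ≤ n) (p q : E)
    (D : ℝ) (hD : D = dist (f^[n] p) (f^[n] q)) (hDδ₁ : D ≤ δ₁)
    (horb : ∀ j < n, f^[j] p ∉ C ∧ f^[j] q ∉ C)
    (hcontr : ∀ j < n, dist (f^[j] p) (f^[j] q) ≤ σ ^ (((n - j : ℕ) : ℝ) / 2) * D)
    (hfar : ∀ j < n, (1 - δ₁) * σ ^ (b * ((n - j : ℕ) : ℝ)) ≤ infDist (f^[j] q) C)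
    (hclose : ∀ j < n, dist (f^[j] p) (f^[j] q) < infDist (f^[j] q) C / 2) :
    abs (∑ j ∈ Finset.range n,
        (Real.log |(fderiv ℝ f (f^[j] q)).det| - Real.log |(fderiv ℝ f (f^[j] p)).det|))
      ≤ B / ((1 - δ₁) ^ β * (1 - σ ^ (1 / 2 - b * β))) * D := by
  have hD0 : 0 ≤ D := hD ▸ dist_nonneg
  have hr0 : 0 ≤ σ ^ (1 / 2 - b * β) := Real.rpow_nonneg hσ0.le _
  have hr1 : σ ^ (1 / 2 - b * β) < 1 := Real.rpow_lt_one hσ0.le hσ1 (sub_pos.mpr hbβ)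
  have hδ : 0 < 1 - δ₁ := sub_pos.mpr hδ₁1
  have hterm : ∀ j ∈ Finset.range n,
      abs (Real.log |(fderiv ℝ f (f^[j] q)).det| - Real.log |(fderiv ℝ f (f^[j] p)).det|)
        ≤ B * D / (1 - δ₁) ^ β * (σ ^ (1 / 2 - b * β)) ^ (n - j) := by
    intro j hj
    rw [Finset.mem_range] at hj
    refine (hdistort _ _ (horb j hj).2 (horb j hj).1 ?_).trans ?_
    · rw [dist_comm]
      exact hclose j hj
    · rw [dist_comm]
      exact mul_div_rpow_le_mul_rpow_pow hB.le hβ.le hσ0 hδ₁1 hD0 (n - j)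
        (hcontr j hj) (hfar j hj)
  calc _ ≤ _ := Finset.abs_sum_le_sum_abs _ _
    _ ≤ _ := Finset.sum_le_sum hterm
    _ = B * D / (1 - δ₁) ^ β * ∑ j ∈ Finset.range n, (σ ^ (1 / 2 - b * β)) ^ (n - j) := by
        rw [Finset.mul_sum]
    _ ≤ B * D / (1 - δ₁) ^ β * (1 - σ ^ (1 / 2 - b * β))⁻¹ := by
        gcongr
        exact sum_range_pow_sub_le_inv_one_sub hr0 hr1 n
    _ = B / ((1 - δ₁) ^ β * (1 - σ ^ (1 / 2 - b * β))) * D := by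
        rw [div_mul_eq_div_div, div_eq_mul_inv _ (1 - σ ^ (1 / 2 - b * β))]
        ring
end

section
/- Let X be a measurable space, f : X → X a measurable map, R : X → ℕ a measurable function with R(x) ≥ 1 for all x, and define the induced map F : X → X by F(x) = f^{R(x)}(x). Let ν be a finite measure on X that is F-invariant (ν(F⁻¹(A)) = ν(A) for all measurable A) and such that R is ν-integrable. Then the measure μ := ∑_{j=0}^{∞} f^j_*(ν|_{\{R > j\}}) is a finite f-invariant measure with total mass μ(X) = ∫ R dν. Moreover, if m is a measure on X such that ν ≪ m and such that m(f⁻¹(N)) = 0 whenever m(N) = 0, then μ ≪ m. -/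
open MeasureTheory

section

variable {X : Type*} [MeasurableSpace X] {f : X → X} {R : X → ℕ}

/-- The layer-cake formula for a function with values in the natural numbers. -/
theorem tsum_measure_lt_eq_lintegral_natCast (hR : Measurable R) (ν : Measure X) :
    ∑' j : ℕ, ν {x | j < R x} = ∫⁻ x, (R x : ENNReal) ∂ν := by
  have hmeas (j : ℕ) : MeasurableSet {x | j < R x} := measurableSet_lt measurable_const hR
  calc ∑' j : ℕ, ν {x | j < R x}
      = ∑' j : ℕ, ∫⁻ x, {x | j < R x}.indicator 1 x ∂ν := by
        simp_rw [lintegral_indicator_one (hmeas _)]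
    _ = ∫⁻ x, ∑' j : ℕ, {x | j < R x}.indicator 1 x ∂ν :=
        (lintegral_tsum fun j => (measurable_one.indicator (hmeas j)).aemeasurable).symm
    _ = ∫⁻ x, (R x : ENNReal) ∂ν := by
        refine lintegral_congr fun x => ?_
        rw [tsum_eq_sum (s := Finset.range (R x))
          (fun j hj => Set.indicator_of_notMem (by simpa using hj) _),
          Finset.sum_congr rfl (fun j hj => Set.indicator_of_mem
            (show x ∈ {x | j < R x} from Finset.mem_range.mp hj) _)]
        simp

/-- The measure of a set under the tower measure `∑ j, f^j_*(ν|_{R > j})`. -/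
theorem sum_map_iterate_restrict_apply (hf : Measurable f) (ν : Measure X)
    {A : Set X} (hA : MeasurableSet A) :
    (Measure.sum fun j : ℕ => (ν.restrict {x | j < R x}).map f^[j]) A =
      ∑' j : ℕ, ν (f^[j] ⁻¹' A ∩ {x | j < R x}) := by
  rw [Measure.sum_apply _ hA]
  refine tsum_congr fun j => ?_
  rw [Measure.map_apply (hf.iterate j) hA, Measure.restrict_apply (hf.iterate j hA)]

/-- The preimage of a set under the induced map, decomposed along the level sets of `R`. -/
theorem measure_preimage_iterate_eq_tsum (hf : Measurable f) (hR : Measurable R)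
    (ν : Measure X) {A : Set X} (hA : MeasurableSet A) :
    ν ((fun x => f^[R x] x) ⁻¹' A) = ∑' j : ℕ, ν (f^[j] ⁻¹' A ∩ {x | R x = j}) := by
  rw [← measure_iUnion]
  · congr 1
    ext x
    simp
  · refine fun i j hij => Set.disjoint_left.mpr ?_
    rintro x ⟨-, hi⟩ ⟨-, hj⟩
    exact hij (hi.symm.trans hj)
  · exact fun j => (hf.iterate j hA).inter (hR (measurableSet_singleton j))

theorem measure_inter_lt_eq_add (hR : Measurable R) (ν : Measure X) (B : Set X) (j : ℕ) :
    ν (B ∩ {x | j < R x}) =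
      ν (B ∩ {x | R x = j + 1}) + ν (B ∩ {x | j + 1 < R x}) := by
  rw [← measure_inter_add_sdiff (B ∩ {x | j < R x}) (hR (measurableSet_singleton (j + 1)))]
  congr 2 <;> ext x <;> simp <;> grind

theorem measure_preimage_iterate_eq_zero {m : Measure X}
    (hm : ∀ N : Set X, m N = 0 → m (f ⁻¹' N) = 0) {N : Set X} (hN : m N = 0) (j : ℕ) :
    m (f^[j] ⁻¹' N) = 0 := by
  induction j with
  | zero => simpa using hN
  | succ j ih => simpa only [Function.iterate_succ, Set.preimage_comp] using hm _ ih

end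

/-- The standard construction of an invariant measure for `f` from an invariant measure of
the induced map `F(x) = f^{R(x)}(x)` with integrable return time `R`:
`μ := ∑_{j} f^j_*(ν|_{R > j})` has total mass `∫ R dν`, is `f`-invariant, and is absolutely
continuous with respect to `m` whenever `ν ≪ m` and `f` is nonsingular for `m`. -/
theorem induced_invariant_measure_construction
    {X : Type*} [MeasurableSpace X]
    (f : X → X) (hf : Measurable f)
    (R : X → ℕ) (hR : Measurable R) (hR1 : ∀ x, 1 ≤ R x)
    (F : X → X) (hF : F = fun x => f^[R x] x)
    (ν : Measure X) [IsFiniteMeasure ν]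
    (hFinv : ∀ A : Set X, MeasurableSet A → ν (F ⁻¹' A) = ν A)
    (hRint : Integrable (fun x => (R x : ℝ)) ν)
    (μ : Measure X)
    (hμ : μ = Measure.sum fun j : ℕ => (ν.restrict {x | j < R x}).map f^[j])
    (m : Measure X) :
    μ Set.univ = ENNReal.ofReal (∫ x, (R x : ℝ) ∂ν) ∧
    (∀ A : Set X, MeasurableSet A → μ (f ⁻¹' A) = μ A) ∧
    (ν ≪ m → (∀ N : Set X, m N = 0 → m (f ⁻¹' N) = 0) → μ ≪ m) := by
  subst hF hμ
  refine ⟨?_, fun A hA => ?_, fun hνm hm => ?_⟩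
  · rw [sum_map_iterate_restrict_apply hf ν MeasurableSet.univ,
      ofReal_integral_eq_lintegral_ofReal hRint (ae_of_all _ fun x => Nat.cast_nonneg _)]
    simpa using tsum_measure_lt_eq_lintegral_natCast hR ν
  · have hlevel : ν A = ∑' j : ℕ, ν (f^[j + 1] ⁻¹' A ∩ {x | R x = j + 1}) := by
      have hempty : {x | R x = 0} = ∅ :=
        Set.eq_empty_of_forall_notMem fun x hx => (Nat.one_le_iff_ne_zero.mp (hR1 x)) hx
      rw [← hFinv A hA, measure_preimage_iterate_eq_tsum hf hR ν hA,
        tsum_eq_zero_add' ENNReal.summable, hempty, Set.inter_empty, measure_empty, zero_add]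
    have hbase : {x | 0 < R x} = Set.univ := Set.eq_univ_of_forall hR1
    rw [sum_map_iterate_restrict_apply hf ν (hf hA), sum_map_iterate_restrict_apply hf ν hA,
      tsum_eq_zero_add' (f := fun j => ν (f^[j] ⁻¹' A ∩ {x | j < R x})) ENNReal.summable,
      hbase, Set.inter_univ, Function.iterate_zero, Set.preimage_id, hlevel, ← ENNReal.tsum_add]
    refine tsum_congr fun j => ?_
    rw [← Set.preimage_comp, ← Function.iterate_succ', measure_inter_lt_eq_add hR]
  · refine Measure.absolutelyContinuous_sum_left fun j => ?_
    refine Measure.AbsolutelyContinuous.mk fun N hN hmN => ?_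
    rw [Measure.map_apply (hf.iterate j) hN]
    exact Measure.absolutelyContinuous_of_le Measure.restrict_le_self
      (hνm (measure_preimage_iterate_eq_zero hm hmN j))
end

section
/- Let (X, μ) be a measure space, f : X → X a measurable map that is nonsingular with respect to μ in the sense that μ(f⁻¹(N)) = 0 whenever μ(N) = 0, let g : X → (0,∞) be measurable and σ ∈ (0,1). For n ≥ 1 define H_n = {x ∈ X : ∏_{j=n−k}^{n−1} g(f^j(x)) ≤ σ^k for every 1 ≤ k ≤ n}. If μ-almost every x ∈ X belongs to H_n for some n ≥ 1, then μ-almost every x ∈ X belongs to H_n for infinitely many n ≥ 1. -/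
open MeasureTheory

/-- Hyperbolic times concatenate: if `n` is a hyperbolic time for `x` and `p` is one for
`f^[n] x`, then `n + p` is a hyperbolic time for `x`. -/
theorem prod_iterate_le_pow_add {X : Type*} {f : X → X} {g : X → ℝ} (hg : ∀ x, 0 ≤ g x)
    {σ : ℝ} (hσ : 0 ≤ σ) {x : X} {n p : ℕ}
    (hn : ∀ k : ℕ, 1 ≤ k → k ≤ n → ∏ j ∈ Finset.Ico (n - k) n, g (f^[j] x) ≤ σ ^ k)
    (hp : ∀ k : ℕ, 1 ≤ k → k ≤ p →
      ∏ j ∈ Finset.Ico (p - k) p, g (f^[j] (f^[n] x)) ≤ σ ^ k)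
    (k : ℕ) (hk : 1 ≤ k) (hkn : k ≤ n + p) :
    ∏ j ∈ Finset.Ico (n + p - k) (n + p), g (f^[j] x) ≤ σ ^ k := by
  have shift (a : ℕ) : ∏ j ∈ Finset.Ico (n + a) (n + p), g (f^[j] x) =
      ∏ j ∈ Finset.Ico a p, g (f^[j] (f^[n] x)) := by
    rw [add_comm n a, add_comm n p, ← Finset.prod_Ico_add']
    simp only [Function.iterate_add_apply]
  rcases le_or_gt k p with hkp | hkp
  · rw [Nat.add_sub_assoc hkp, shift]
    exact hp k hk hkp
  · have htail : ∏ j ∈ Finset.Ico n (n + p), g (f^[j] x) ≤ σ ^ p := by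
      rcases Nat.eq_zero_or_pos p with rfl | hp0
      · simp
      · have h := hp p hp0 le_rfl
        rwa [Nat.sub_self, ← shift, Nat.add_zero] at h
    have hhead := hn (k - p) (by omega) (by omega)
    rw [← Finset.prod_Ico_consecutive _ (show n + p - k ≤ n by omega) (Nat.le_add_right n p),
      show n + p - k = n - (k - p) by omega, show σ ^ k = σ ^ (k - p) * σ ^ p by
        rw [← pow_add, Nat.sub_add_cancel hkp.le]]
    exact mul_le_mul hhead htail (Finset.prod_nonneg fun _ _ => hg _) (pow_nonneg hσ _)

/-- If `f` is nonsingular with respect to `μ` and almost every point has some σ-hyperbolic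
time (with respect to the cocycle `g`), then almost every point has infinitely many
σ-hyperbolic times. -/
theorem infinitely_many_hyperbolic_times
    {X : Type*} [MeasurableSpace X] (μ : Measure X)
    (f : X → X) (hf : Measurable f)
    (hns : ∀ N : Set X, MeasurableSet N → μ N = 0 → μ (f ⁻¹' N) = 0)
    (g : X → ℝ) (hg : Measurable g) (hgpos : ∀ x, 0 < g x)
    (σ : ℝ) (hσ0 : 0 < σ) (hσ1 : σ < 1)
    (H : ℕ → Set X)
    (hH : ∀ n : ℕ, H n =
      {x | ∀ k : ℕ, 1 ≤ k → k ≤ n → ∏ j ∈ Finset.Ico (n - k) n, g (f^[j] x) ≤ σ ^ k})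
    (hae : ∀ᵐ x ∂μ, ∃ n : ℕ, 1 ≤ n ∧ x ∈ H n) :
    ∀ᵐ x ∂μ, {n : ℕ | 1 ≤ n ∧ x ∈ H n}.Infinite := by
  have hqmp : Measure.QuasiMeasurePreserving f μ μ :=
    ⟨hf, Measure.AbsolutelyContinuous.mk fun N hN h0 => by
      rw [Measure.map_apply hf hN]
      exact hns N hN h0⟩
  filter_upwards [ae_all_iff.2 fun m => (hqmp.iterate m).ae hae] with x hx
  refine Set.infinite_of_forall_exists_gt fun a => ?_
  induction a with
  | zero =>
    obtain ⟨n, hn, hxn⟩ := hx 0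
    exact ⟨n, ⟨hn, hxn⟩, hn⟩
  | succ a ih =>
    obtain ⟨n, ⟨hn, hxn⟩, han⟩ := ih
    obtain ⟨p, hp, hxp⟩ := hx n
    refine ⟨n + p, ⟨by omega, ?_⟩, by omega⟩
    rw [hH] at hxn hxp ⊢
    exact prod_iterate_le_pow_add (fun y => (hgpos y).le) hσ0.le hxn hxp
end
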